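/- Let X = [−1,1] with the Euclidean metric, let P(X) be the smallest d-structure containing the paths γ1(t) = t and γ2(t) = −t, and let X* be the reversed d-space. Then every d-map F : X → X* satisfies dis(F) ≥ 1, and likewise every d-map G : X* → X satisfies dis(G) ≥ 1, where distortion is taken with respect to the induced zigzag distances. -/

import Mathlib

open scoped ENNReal

noncomputable section

/-- The length of a path `γ : ℝ → X`: its total variation on `[0,1]`. -/
def pathLen {X : Type*} [PseudoEMetricSpace X] (γ : ℝ → X) : ℝ≥0∞ :=
  eVariationOn γ (Set.Icc 0 1)

/-- `P` is a d-space structure on `X`: it contains all constant paths, is closed under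
precomposition with continuous nondecreasing maps `[0,1] → [0,1]`, and is closed under
concatenation; all members are continuous on `[0,1]`. -/
structure IsDSpace {X : Type*} [MetricSpace X] (P : Set (ℝ → X)) : Prop where
  cont : ∀ γ ∈ P, ContinuousOn γ (Set.Icc (0:ℝ) 1)
  const_mem : ∀ x : X, (fun _ : ℝ => x) ∈ P
  reparam : ∀ γ ∈ P, ∀ h : ℝ → ℝ, ContinuousOn h (Set.Icc (0:ℝ) 1) →
    MonotoneOn h (Set.Icc (0:ℝ) 1) → Set.MapsTo h (Set.Icc (0:ℝ) 1) (Set.Icc (0:ℝ) 1) →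
    γ ∘ h ∈ P
  concat : ∀ γ ∈ P, ∀ γ' ∈ P, γ 1 = γ' 0 →
    (fun t : ℝ => if t ≤ 1/2 then γ (2*t) else γ' (2*t - 1)) ∈ P

/-- A d-structure is rectifiable if every d-path has finite length. -/
def IsRectifiable {X : Type*} [MetricSpace X] (P : Set (ℝ → X)) : Prop :=
  ∀ γ ∈ P, pathLen γ ≠ ⊤

/-- `γ` is a d-path from `x` to `x'`. -/
def IsDPathFrom {X : Type*} (P : Set (ℝ → X)) (x x' : X) (γ : ℝ → X) : Prop :=
  γ ∈ P ∧ γ 0 = x ∧ γ 1 = x'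

/-- `L` is a zigzag path between `x` and `x'`: a finite sequence of d-paths, each joining
consecutive points `p i`, `p (i+1)` in one direction or the other. -/
def IsZigzagFrom {X : Type*} (P : Set (ℝ → X)) (x x' : X) (L : List (ℝ → X)) : Prop :=
  ∃ p : ℕ → X, p 0 = x ∧ p L.length = x' ∧
    ∀ i : Fin L.length,
      IsDPathFrom P (p i) (p (i + 1)) (L.get i) ∨ IsDPathFrom P (p (i + 1)) (p i) (L.get i)

/-- The length of a zigzag path: the sum of the lengths of its pieces. -/
def zigzagLen {X : Type*} [PseudoEMetricSpace X] (L : List (ℝ → X)) : ℝ≥0∞ :=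
  (L.map pathLen).sum

/-- The zigzag (extended) distance induced by a d-structure `P`. -/
def zzDist {X : Type*} [MetricSpace X] (P : Set (ℝ → X)) (x x' : X) : ℝ≥0∞ :=
  ⨅ L ∈ {L : List (ℝ → X) | IsZigzagFrom P x x' L}, zigzagLen L

/-- Any two points are joined by a zigzag path. -/
def ZigzagConnected {X : Type*} (P : Set (ℝ → X)) : Prop :=
  ∀ x x' : X, ∃ L, IsZigzagFrom P x x' L

/-- A d-map: continuous and sending d-paths to d-paths. -/
def IsDMap {X Y : Type*} [MetricSpace X] [MetricSpace Y]
    (PX : Set (ℝ → X)) (PY : Set (ℝ → Y)) (F : X → Y) : Prop :=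
  Continuous F ∧ ∀ γ ∈ PX, F ∘ γ ∈ PY

/-- The reversed d-structure: `γ ∈ reverseP P` iff `t ↦ γ (1 - t)` belongs to `P`. -/
def reverseP {X : Type*} (P : Set (ℝ → X)) : Set (ℝ → X) :=
  {γ | (fun t => γ (1 - t)) ∈ P}

/-- `|a - b|` for extended nonnegative reals. -/
def ediffAbs (a b : ℝ≥0∞) : ℝ≥0∞ := (a - b) ⊔ (b - a)

/-- Distortion of a map with respect to extended distances on source and target. -/
def edis {X Y : Type*} (dX : X → X → ℝ≥0∞) (dY : Y → Y → ℝ≥0∞) (F : X → Y) : ℝ≥0∞ :=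
  ⨆ x : X, ⨆ x' : X, ediffAbs (dX x x') (dY (F x) (F x'))

/-- Codistortion of a pair of maps with respect to extended distances. -/
def ecodis {X Y : Type*} (dX : X → X → ℝ≥0∞) (dY : Y → Y → ℝ≥0∞)
    (F : X → Y) (G : Y → X) : ℝ≥0∞ :=
  ⨆ x : X, ⨆ y : Y, ediffAbs (dX x (G y)) (dY (F x) y)

/-- The distortion distance between two d-spaces: half the infimum, over pairs of d-maps,
of the maximum of the two distortions and the codistortion (w.r.t. zigzag distances). -/
def ddis {X Y : Type*} [MetricSpace X] [MetricSpace Y]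
    (PX : Set (ℝ → X)) (PY : Set (ℝ → Y)) : ℝ≥0∞ :=
  (1/2 : ℝ≥0∞) * ⨅ (F : {F : X → Y // IsDMap PX PY F}) (G : {G : Y → X // IsDMap PY PX G}),
    max (edis (zzDist PX) (zzDist PY) F.1)
      (max (edis (zzDist PY) (zzDist PX) G.1) (ecodis (zzDist PX) (zzDist PY) F.1 G.1))

/-- A d-correspondence: a relation with surjective projections that matches reachability. -/
def IsDCorrespondence {X Y : Type*} (PX : Set (ℝ → X)) (PY : Set (ℝ → Y))
    (R : Set (X × Y)) : Prop :=
  (∀ x : X, ∃ y : Y, (x, y) ∈ R) ∧ (∀ y : Y, ∃ x : X, (x, y) ∈ R) ∧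
  ∀ p ∈ R, ∀ q ∈ R,
    ((∃ γ, IsDPathFrom PX p.1 q.1 γ) ↔ (∃ γ, IsDPathFrom PY p.2 q.2 γ))

/-- Distortion of a correspondence with respect to the zigzag distances. -/
def corDis {X Y : Type*} [MetricSpace X] [MetricSpace Y]
    (PX : Set (ℝ → X)) (PY : Set (ℝ → Y)) (R : Set (X × Y)) : ℝ≥0∞ :=
  ⨆ p : R, ⨆ q : R, ediffAbs (zzDist PX p.1.1 q.1.1) (zzDist PY p.1.2 q.1.2)

/-- The d-correspondence distortion distance. -/
def dcdis {X Y : Type*} [MetricSpace X] [MetricSpace Y]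
    (PX : Set (ℝ → X)) (PY : Set (ℝ → Y)) : ℝ≥0∞ :=
  (1/2 : ℝ≥0∞) * ⨅ R : {R : Set (X × Y) // IsDCorrespondence PX PY R}, corDis PX PY R.1

/-- Hausdorff distance between two subsets w.r.t. an extended distance. -/
def ehausdorffDist {Z : Type*} (d : Z → Z → ℝ≥0∞) (s t : Set Z) : ℝ≥0∞ :=
  max (⨆ a ∈ s, ⨅ b ∈ t, d a b) (⨆ b ∈ t, ⨅ a ∈ s, d a b)

/-- The interval `[-1, 1]` with the Euclidean metric. -/
abbrev MInt : Type := {x : ℝ // x ∈ Set.Icc (-1:ℝ) 1}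

/-- Clamp a real number into `[-1, 1]`. -/
def clampM (t : ℝ) : MInt :=
  ⟨max (-1) (min 1 t), ⟨le_max_left _ _, max_le (by norm_num) (min_le_left _ _)⟩⟩

/-- The path `γ₁(t) = t` (for `t ∈ [0,1]`). -/
def gone : ℝ → MInt := fun t => clampM t

/-- The path `γ₂(t) = -t` (for `t ∈ [0,1]`). -/
def gtwo : ℝ → MInt := fun t => clampM (-t)

/-- The smallest d-structure on `[-1,1]` containing `γ₁` and `γ₂`: the intersection of all
d-structures containing them. -/
def mintP : Set (ℝ → MInt) :=
  ⋂₀ {P : Set (ℝ → MInt) | IsDSpace P ∧ {gone, gtwo} ⊆ P}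

/-- The extended distance is a lower bound for the zigzag distance. -/
theorem edist_le_zzDist {X : Type*} [MetricSpace X] (P : Set (ℝ → X)) (x x' : X) :
    edist x x' ≤ zzDist P x x' := by
  refine le_iInf₂ fun L ⟨p, h0, h1, hp⟩ => ?_
  have key : ∀ i : Fin L.length, edist (p i) (p (i + 1)) ≤ pathLen (L.get i) := by
    intro i
    have h : edist (L.get i 0) (L.get i 1) ≤ pathLen (L.get i) :=
      eVariationOn.edist_le _ (by simp) (by simp)
    rcases hp i with ⟨-, ha, hb⟩ | ⟨-, ha, hb⟩
    · rwa [ha, hb] at h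
    · rwa [ha, hb, edist_comm] at h
  calc edist x x' = edist (p 0) (p L.length) := by rw [h0, h1]
    _ ≤ ∑ i ∈ Finset.range L.length, edist (p i) (p (i + 1)) := edist_le_range_sum_edist p _
    _ = ∑ i : Fin L.length, edist (p i) (p (i + 1)) :=
        Finset.sum_range fun i => edist (p i) (p (i + 1))
    _ ≤ ∑ i : Fin L.length, pathLen (L.get i) := Finset.sum_le_sum fun i _ => key i
    _ = zigzagLen L := by
        rw [zigzagLen, ← List.sum_ofFn]
        congr 1
        exact List.ofFn_getElem_eq_map L pathLen

theorem zzDist_le_pathLen {X : Type*} [MetricSpace X] {P : Set (ℝ → X)} {x x' : X} {γ : ℝ → X}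
    (h : IsDPathFrom P x x' γ ∨ IsDPathFrom P x' x γ) : zzDist P x x' ≤ pathLen γ := by
  refine (iInf₂_le [γ] ?_).trans (by simp [zigzagLen])
  refine ⟨fun i => if i = 0 then x else x', by simp, by simp, fun i => ?_⟩
  have hi : i = ⟨0, by simp⟩ := Fin.ext (by simp)
  subst hi
  simpa using h

theorem pathLen_reverse_le {X : Type*} [PseudoEMetricSpace X] (γ : ℝ → X) :
    pathLen (fun t => γ (1 - t)) ≤ pathLen γ := by
  refine eVariationOn.comp_le_of_antitoneOn γ (fun t : ℝ => 1 - t) ?_ ?_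
  · intro a _ b _ hab
    simp only
    linarith
  · intro a ha
    exact ⟨by linarith [ha.2], by linarith [ha.1]⟩

theorem zzDist_reverseP_le_pathLen {X : Type*} [MetricSpace X] {P : Set (ℝ → X)} {x x' : X}
    {γ : ℝ → X} (h : IsDPathFrom P x x' γ ∨ IsDPathFrom P x' x γ) :
    zzDist (reverseP P) x x' ≤ pathLen γ := by
  have rev : ∀ {a b : X}, IsDPathFrom P a b γ →
      IsDPathFrom (reverseP P) b a (fun t => γ (1 - t)) := by
    rintro a b ⟨hm, ha, hb⟩
    exact ⟨by simpa [reverseP] using hm, by simpa using hb, by simpa using ha⟩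
  exact (zzDist_le_pathLen (h.symm.imp rev rev)).trans (pathLen_reverse_le γ)

/-- The continuous paths in `[-1,1]` whose distance to `0` never decreases form a d-structure. -/
theorem isDSpace_monotoneOn_abs :
    IsDSpace {γ : ℝ → MInt | ContinuousOn γ (Set.Icc 0 1) ∧
      MonotoneOn (fun t => |(γ t : ℝ)|) (Set.Icc 0 1)} where
  cont γ h := h.1
  const_mem x := ⟨continuousOn_const, monotoneOn_const⟩
  reparam γ hγ h hc hm hmaps := ⟨hγ.1.comp hc hmaps, hγ.2.comp hm hmaps⟩
  concat γ hγ γ' hγ' h := by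
    have hU : Set.Icc (0:ℝ) 1 = Set.Icc 0 (1/2) ∪ Set.Icc (1/2) 1 :=
      (Set.Icc_union_Icc_eq_Icc (by norm_num) (by norm_num)).symm
    have hl : Set.MapsTo (fun t : ℝ => 2 * t) (Set.Icc 0 (1/2)) (Set.Icc 0 1) := fun t ht =>
      ⟨by linarith [ht.1], by linarith [ht.2]⟩
    have hr : Set.MapsTo (fun t : ℝ => 2 * t - 1) (Set.Icc (1/2) 1) (Set.Icc 0 1) := fun t ht =>
      ⟨by linarith [ht.1], by linarith [ht.2]⟩
    have el : Set.EqOn (fun t : ℝ => if t ≤ 1/2 then γ (2*t) else γ' (2*t - 1))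
        (fun t => γ (2 * t)) (Set.Icc 0 (1/2)) := fun t ht => if_pos ht.2
    have er : Set.EqOn (fun t : ℝ => if t ≤ 1/2 then γ (2*t) else γ' (2*t - 1))
        (fun t => γ' (2 * t - 1)) (Set.Icc (1/2) 1) := by
      intro t ht
      rcases ht.1.eq_or_lt with rfl | hlt
      · simpa using h
      · exact if_neg hlt.not_ge
    constructor
    · rw [hU]
      refine ContinuousOn.union_of_isClosed ?_ ?_ isClosed_Icc isClosed_Icc
      · exact (hγ.1.comp (by fun_prop) hl).congr el
      · exact (hγ'.1.comp (by fun_prop) hr).congr er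
    · rw [hU]
      refine MonotoneOn.union_right (c := 1/2) ?_ ?_
        (isGreatest_Icc (by norm_num)) (isLeast_Icc (by norm_num))
      · intro a ha b hb hab
        simp only [el ha, el hb]
        exact hγ.2 (hl ha) (hl hb) (by linarith)
      · intro a ha b hb hab
        simp only [er ha, er hb]
        exact hγ'.2 (hr ha) (hr hb) (by linarith)

theorem coe_clampM {t : ℝ} (h : t ∈ Set.Icc (-1:ℝ) 1) : (clampM t : ℝ) = t := by
  simp [clampM, h.1, h.2]

theorem clampM_coe (x : MInt) : clampM x = x := Subtype.ext (coe_clampM x.2)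

theorem continuous_clampM : Continuous clampM := by
  unfold clampM
  fun_prop

theorem gone_mem_mintP : gone ∈ mintP := fun _ hP => hP.2 (by simp)

theorem gtwo_mem_mintP : gtwo ∈ mintP := fun _ hP => hP.2 (by simp)

theorem mintP_subset : mintP ⊆ {γ : ℝ → MInt | ContinuousOn γ (Set.Icc 0 1) ∧
    MonotoneOn (fun t => |(γ t : ℝ)|) (Set.Icc 0 1)} := by
  refine Set.sInter_subset_of_mem ⟨isDSpace_monotoneOn_abs, ?_⟩
  have key : ∀ t ∈ Set.Icc (0:ℝ) 1, |(gone t : ℝ)| = t ∧ |(gtwo t : ℝ)| = t := by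
    intro t ht
    rw [gone, gtwo, coe_clampM ⟨by linarith [ht.1], ht.2⟩,
      coe_clampM ⟨by linarith [ht.2], by linarith [ht.1]⟩, abs_neg, abs_of_nonneg ht.1]
    exact ⟨rfl, rfl⟩
  rintro γ (rfl | rfl)
  · exact ⟨continuous_clampM.continuousOn, monotoneOn_id.congr fun t ht => (key t ht).1.symm⟩
  · exact ⟨(continuous_clampM.comp continuous_neg).continuousOn,
      monotoneOn_id.congr fun t ht => (key t ht).2.symm⟩

theorem comp_mem_mintP {γ : ℝ → MInt} (hγ : γ ∈ mintP) {h : ℝ → ℝ}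
    (hc : ContinuousOn h (Set.Icc 0 1)) (hm : MonotoneOn h (Set.Icc 0 1))
    (hmaps : Set.MapsTo h (Set.Icc 0 1) (Set.Icc 0 1)) : γ ∘ h ∈ mintP :=
  fun P hP => hP.1.reparam γ (hγ P hP) h hc hm hmaps

/-- A d-path ending in `[0,1]` starts in `[0,1]`. -/
theorem nonneg_start_of_mem_mintP {γ : ℝ → MInt} (hγ : γ ∈ mintP) (h : 0 ≤ (γ 1 : ℝ)) :
    0 ≤ (γ 0 : ℝ) := by
  by_contra! h0
  obtain ⟨hc, hm⟩ := mintP_subset hγ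
  obtain ⟨c, hc, hc0⟩ := intermediate_value_Icc zero_le_one
    (continuous_subtype_val.comp_continuousOn hc) ⟨h0.le, h⟩
  have := hm (by simp) hc hc.1
  simp only [Function.comp_apply] at hc0
  simp only [hc0, abs_zero, abs_nonpos_iff] at this
  exact h0.ne this

/-- A d-path ending in `[-1,0]` starts in `[-1,0]`. -/
theorem nonpos_start_of_mem_mintP {γ : ℝ → MInt} (hγ : γ ∈ mintP) (h : (γ 1 : ℝ) ≤ 0) :
    (γ 0 : ℝ) ≤ 0 := by
  by_contra! h0
  obtain ⟨hc, hm⟩ := mintP_subset hγ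
  obtain ⟨c, hc, hc0⟩ := intermediate_value_Icc' zero_le_one
    (continuous_subtype_val.comp_continuousOn hc) ⟨h, h0.le⟩
  have := hm (by simp) hc hc.1
  simp only [Function.comp_apply] at hc0
  simp only [hc0, abs_zero, abs_nonpos_iff] at this
  exact h0.ne' this

/-- Two points `γ a`, `γ b` with `a ≤ b` on a d-path of length at most `1` are joined by
a reparametrised piece of that path, again of length at most `1`. -/
theorem exists_dpath_pathLen_le_one {γ : ℝ → MInt} (hγ : γ ∈ mintP) (hl : pathLen γ ≤ 1)
    {a b : ℝ} (ha : 0 ≤ a) (hab : a ≤ b) (hb : b ≤ 1) :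
    ∃ σ, IsDPathFrom mintP (γ a) (γ b) σ ∧ pathLen σ ≤ 1 := by
  have hm : MonotoneOn (fun t : ℝ => a + (b - a) * t) (Set.Icc 0 1) := by
    intro s _ t _ hst
    have := mul_le_mul_of_nonneg_left hst (sub_nonneg.2 hab)
    simp only
    linarith
  have hmaps : Set.MapsTo (fun t : ℝ => a + (b - a) * t) (Set.Icc 0 1) (Set.Icc 0 1) := by
    intro t ht
    have h0 := mul_nonneg (sub_nonneg.2 hab) ht.1
    have h1 := mul_le_mul_of_nonneg_left ht.2 (sub_nonneg.2 hab)
    exact ⟨by linarith, by linarith⟩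
  exact ⟨γ ∘ fun t => a + (b - a) * t,
    ⟨comp_mem_mintP hγ (by fun_prop) hm hmaps, by simp, by simp⟩,
    (eVariationOn.comp_le_of_monotoneOn γ _ hm hmaps).trans hl⟩

theorem pathLen_le_one_of_lipschitzOnWith {X : Type*} [PseudoEMetricSpace X] {γ : ℝ → X}
    (h : LipschitzOnWith 1 γ (Set.Icc 0 1)) : pathLen γ ≤ 1 := by
  have hid := (monotoneOn_id (s := Set.Icc (0:ℝ) 1)).eVariationOn_eq (a := 0) (b := 1)
    (by simp) (by simp)
  rw [Set.inter_self] at hid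
  simpa [pathLen, hid] using h.comp_eVariationOn_le (Set.mapsTo_id _)

theorem pathLen_gone_le : pathLen gone ≤ 1 := by
  refine pathLen_le_one_of_lipschitzOnWith (LipschitzOnWith.of_dist_le_mul fun s hs t ht => ?_)
  rw [gone, gone, Subtype.dist_eq, coe_clampM ⟨by linarith [hs.1], hs.2⟩,
    coe_clampM ⟨by linarith [ht.1], ht.2⟩, NNReal.coe_one, one_mul]

theorem pathLen_gtwo_le : pathLen gtwo ≤ 1 := by
  refine pathLen_le_one_of_lipschitzOnWith (LipschitzOnWith.of_dist_le_mul fun s hs t ht => ?_)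
  rw [gtwo, gtwo, Subtype.dist_eq, coe_clampM ⟨by linarith [hs.2], by linarith [hs.1]⟩,
    coe_clampM ⟨by linarith [ht.2], by linarith [ht.1]⟩, dist_neg_neg, NNReal.coe_one, one_mul]

/-- Two points on the same side of `0` are joined, in one direction or the other, by a d-path of
length at most `1`. -/
theorem exists_dpath_of_same_side (x y : MInt)
    (h : (0 ≤ (x : ℝ) ∧ 0 ≤ (y : ℝ)) ∨ ((x : ℝ) ≤ 0 ∧ (y : ℝ) ≤ 0)) :
    ∃ σ, (IsDPathFrom mintP x y σ ∨ IsDPathFrom mintP y x σ) ∧ pathLen σ ≤ 1 := by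
  have pos : ∀ x y : MInt, 0 ≤ (x : ℝ) → (x : ℝ) ≤ y →
      ∃ σ, IsDPathFrom mintP x y σ ∧ pathLen σ ≤ 1 := by
    intro x y hx hxy
    simpa only [gone, clampM_coe] using
      exists_dpath_pathLen_le_one gone_mem_mintP pathLen_gone_le hx hxy y.2.2
  have neg : ∀ x y : MInt, (x : ℝ) ≤ 0 → (y : ℝ) ≤ x →
      ∃ σ, IsDPathFrom mintP x y σ ∧ pathLen σ ≤ 1 := by
    intro x y hx hxy
    simpa only [gtwo, neg_neg, clampM_coe] using
      exists_dpath_pathLen_le_one gtwo_mem_mintP pathLen_gtwo_le (neg_nonneg.2 hx)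
        (neg_le_neg hxy) (neg_le.1 y.2.1)
  rcases h with ⟨hx, hy⟩ | ⟨hx, hy⟩ <;> rcases le_total (x : ℝ) y with hxy | hxy
  · exact (pos x y hx hxy).imp fun _ => And.imp_left Or.inl
  · exact (pos y x hy hxy).imp fun _ => And.imp_left Or.inr
  · exact (neg y x hy hxy).imp fun _ => And.imp_left Or.inr
  · exact (neg x y hx hxy).imp fun _ => And.imp_left Or.inl

/-- A map reversing d-paths sends the two endpoints to the same side of `0`. -/
theorem exists_dpath_between_endpoints (F : MInt → MInt)
    (hF : ∀ γ ∈ mintP, (fun t => F (γ (1 - t))) ∈ mintP) :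
    ∃ σ, (IsDPathFrom mintP (F (clampM 1)) (F (clampM (-1))) σ ∨
      IsDPathFrom mintP (F (clampM (-1))) (F (clampM 1)) σ) ∧ pathLen σ ≤ 1 := by
  have h1 := hF _ gone_mem_mintP
  have h2 := hF _ gtwo_mem_mintP
  apply exists_dpath_of_same_side
  refine (le_total 0 (F (clampM 0) : ℝ)).imp (fun h => ?_) (fun h => ?_)
  · have a := nonneg_start_of_mem_mintP h1 (by simpa [gone] using h)
    have b := nonneg_start_of_mem_mintP h2 (by simpa [gtwo] using h)
    simp only [gone, gtwo, sub_zero] at a b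
    exact ⟨a, b⟩
  · have a := nonpos_start_of_mem_mintP h1 (by simpa [gone] using h)
    have b := nonpos_start_of_mem_mintP h2 (by simpa [gtwo] using h)
    simp only [gone, gtwo, sub_zero] at a b
    exact ⟨a, b⟩

theorem one_le_edis {X Y : Type*} {dX : X → X → ℝ≥0∞} {dY : Y → Y → ℝ≥0∞} {F : X → Y} {x x' : X}
    (hX : 2 ≤ dX x x') (hY : dY (F x) (F x') ≤ 1) : 1 ≤ edis dX dY F := by
  refine le_trans ?_ (le_iSup₂ x x')
  refine le_trans ?_ le_sup_left
  calc (1 : ℝ≥0∞) = 2 - 1 := by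
        rw [← one_add_one_eq_two, ENNReal.add_sub_cancel_right ENNReal.one_ne_top]
    _ ≤ _ := tsub_le_tsub hX hY

theorem two_le_zzDist_endpoints (P : Set (ℝ → MInt)) :
    2 ≤ zzDist P (clampM 1) (clampM (-1)) := by
  refine le_trans ?_ (edist_le_zzDist P _ _)
  rw [edist_dist, Subtype.dist_eq, coe_clampM (by norm_num), coe_clampM (by norm_num),
    Real.dist_eq]
  norm_num

/-- Every d-map `F : X → X*` (and every d-map `G : X* → X`) has
distortion at least `1`, with respect to the induced zigzag distances. -/
theorem dis_ge_one_mint_reverse :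
    (∀ F : MInt → MInt, IsDMap mintP (reverseP mintP) F →
      1 ≤ edis (zzDist mintP) (zzDist (reverseP mintP)) F) ∧
    (∀ G : MInt → MInt, IsDMap (reverseP mintP) mintP G →
      1 ≤ edis (zzDist (reverseP mintP)) (zzDist mintP) G) := by
  refine ⟨fun F hF => ?_, fun G hG => ?_⟩
  · obtain ⟨σ, hσ, hl⟩ := exists_dpath_between_endpoints F fun γ hγ => hF.2 γ hγ
    exact one_le_edis (two_le_zzDist_endpoints _) ((zzDist_reverseP_le_pathLen hσ).trans hl)
  · obtain ⟨σ, hσ, hl⟩ := exists_dpath_between_endpoints G fun γ hγ =>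
      hG.2 (fun t => γ (1 - t)) (by simpa [reverseP] using hγ)
    exact one_le_edis (two_le_zzDist_endpoints _) ((zzDist_le_pathLen hσ).trans hl)
end
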